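/- Let i be an odd integer with i ≡ 3 (mod 4) and i ≥ 7 (so that (i+1)/2 is even). Then for every t ∈ {1, …, (i−3)/4}, S(i) = ⟨2, (i+1)/2 + 2t + 1⟩ ∩ (⋂_{k = t}^{(i−3)/4} T((i+1)/2 + 2k + 1)), and this is a factorization of S(i) into irreducibles (in particular, the intersection cannot be refined: removing any one of the numerical semigroups from the intersection strictly enlarges it). -/

import Mathlib

/-- A numerical semigroup: a submonoid of `(ℕ, +)` with finite complement. -/
structure NumericalSemigroup where
  carrier : Set ℕ
  zero_mem : 0 ∈ carrier
  add_mem : ∀ ⦃a b : ℕ⦄, a ∈ carrier → b ∈ carrier → a + b ∈ carrier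
  cofinite : (carrierᶜ : Set ℕ).Finite

/-- A numerical semigroup is irreducible if it is not the intersection of two
numerical semigroups properly containing it. -/
def NumericalSemigroup.Irred (S : NumericalSemigroup) : Prop :=
  ¬ ∃ A B : NumericalSemigroup,
      S.carrier ⊂ A.carrier ∧ S.carrier ⊂ B.carrier ∧
      S.carrier = A.carrier ∩ B.carrier

/-- `F : Fin n → NumericalSemigroup` is a factorization of `S` (of length `n`)
into irreducibles: each factor is irreducible, `S` is the intersection of the
factors, and the intersection cannot be refined (no proper subfamily has
intersection `S`). -/
def IsFactorization (S : NumericalSemigroup) {n : ℕ}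
    (F : Fin n → NumericalSemigroup) : Prop :=
  (∀ j, (F j).Irred) ∧
  S.carrier = ⋂ j, (F j).carrier ∧
  ∀ J : Set (Fin n), J ≠ Set.univ → S.carrier ≠ ⋂ j ∈ J, (F j).carrier

/-- `S` admits a factorization into irreducibles of length `n`. -/
def HasFactorizationOfLength (S : NumericalSemigroup) (n : ℕ) : Prop :=
  ∃ F : Fin n → NumericalSemigroup, IsFactorization S F

/-- The set of lengths `Lᵐ(S)` of factorizations of `S` into irreducibles. -/
def LengthSet (S : NumericalSemigroup) : Set ℕ :=
  {n | HasFactorizationOfLength S n}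

/-- The underlying set of `T(m) = {0} ∪ {(m+1)/2, …, m-1} ∪ {m+1, m+2, …}`. -/
def Tset (m : ℕ) : Set ℕ :=
  {0} ∪ Set.Icc ((m + 1) / 2) (m - 1) ∪ Set.Ici (m + 1)

/-- The underlying set of the numerical semigroup `⟨2, m⟩` generated by `2` and `m`. -/
def gen2 (m : ℕ) : Set ℕ := {n | ∃ a b : ℕ, n = 2 * a + m * b}

/-- The underlying set of `S(i) = ⟨2, i⟩ ∩ T(i)`. -/
def Sset (i : ℕ) : Set ℕ := gen2 i ∩ Tset i

/-- The set of special gaps of `S`: gaps `g` such that `S ∪ {g}` is again a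
numerical semigroup. -/
def SpecialGaps (S : NumericalSemigroup) : Set ℕ :=
  {g | g ∉ S.carrier ∧ ∃ T : NumericalSemigroup, T.carrier = insert g S.carrier}

/-- A numerical semigroup is irreducible as soon as it has a gap `f` such that every gap `x`
satisfies `f - x ∈ S` (that is, as soon as it is symmetric). -/
theorem NumericalSemigroup.Irred.of_symmetric {S : NumericalSemigroup} {f : ℕ}
    (hf : f ∉ S.carrier) (h : ∀ x ∉ S.carrier, ∃ s ∈ S.carrier, x + s = f) : S.Irred := by
  have mem_of_ssubset : ∀ A : NumericalSemigroup, S.carrier ⊂ A.carrier → f ∈ A.carrier := by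
    intro A hA
    obtain ⟨x, hxA, hxS⟩ := Set.exists_of_ssubset hA
    obtain ⟨s, hs, rfl⟩ := h x hxS
    exact A.add_mem hxA (hA.subset hs)
  rintro ⟨A, B, hA, hB, hAB⟩
  exact hf (hAB ▸ ⟨mem_of_ssubset A hA, mem_of_ssubset B hB⟩)

theorem mem_gen2_iff {m : ℕ} (hm : m % 2 = 1) (n : ℕ) : n ∈ gen2 m ↔ n % 2 = 0 ∨ m ≤ n := by
  constructor
  · rintro ⟨a, b, rfl⟩
    rcases Nat.eq_zero_or_pos b with rfl | hb
    · left; omega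
    · right; nlinarith
  · intro h
    by_cases hn : n % 2 = 0
    · exact ⟨n / 2, 0, by omega⟩
    · exact ⟨(n - m) / 2, 1, by omega⟩

theorem mem_Tset_iff {m : ℕ} (hm : 0 < m) (n : ℕ) :
    n ∈ Tset m ↔ n = 0 ∨ (m + 1) / 2 ≤ n ∧ n ≠ m := by
  simp only [Tset, Set.mem_union, Set.mem_singleton_iff, Set.mem_Icc, Set.mem_Ici]
  omega

theorem irred_of_carrier_eq_gen2 {m : ℕ} (hm : m % 2 = 1) (hm3 : 3 ≤ m) {A : NumericalSemigroup}
    (hA : A.carrier = gen2 m) : A.Irred := by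
  apply NumericalSemigroup.Irred.of_symmetric (f := m - 2)
  · rw [hA, mem_gen2_iff hm]; omega
  · intro x hx
    rw [hA, mem_gen2_iff hm] at hx
    exact ⟨m - 2 - x, by rw [hA, mem_gen2_iff hm]; omega, by omega⟩

theorem irred_of_carrier_eq_Tset {m : ℕ} (hm : m % 2 = 1) {T : NumericalSemigroup}
    (hT : T.carrier = Tset m) : T.Irred := by
  have hm0 : 0 < m := by omega
  apply NumericalSemigroup.Irred.of_symmetric (f := m)
  · rw [hT, mem_Tset_iff hm0]; omega
  · intro x hx
    rw [hT, mem_Tset_iff hm0] at hx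
    exact ⟨m - x, by rw [hT, mem_Tset_iff hm0]; omega, by omega⟩

theorem mem_Sset_iff {i : ℕ} (hi : i % 2 = 1) (n : ℕ) :
    n ∈ Sset i ↔ n = 0 ∨ (i + 1) / 2 ≤ n ∧ (n % 2 = 0 ∨ i < n) := by
  rw [Sset, Set.mem_inter_iff, mem_gen2_iff hi, mem_Tset_iff (by omega)]
  omega

/-- For odd `i ≡ 3 (mod 4)`, `i ≥ 7` and `t ∈ {1, …, (i-3)/4}`,
`S(i) = ⟨2, (i+1)/2 + 2t + 1⟩ ∩ ⋂_{k=t}^{(i-3)/4} T((i+1)/2 + 2k + 1)`, each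
factor is irreducible, and removing any factor strictly enlarges the
intersection. -/
theorem factorization_Si_general (i : ℕ) (hi : i % 4 = 3) (hi7 : 7 ≤ i)
    (t : ℕ) (ht1 : 1 ≤ t) (ht : t ≤ (i - 3) / 4) :
    (Sset i = gen2 ((i + 1) / 2 + 2 * t + 1) ∩
        ⋂ k ∈ Set.Icc t ((i - 3) / 4), Tset ((i + 1) / 2 + 2 * k + 1)) ∧
    (∀ A : NumericalSemigroup, A.carrier = gen2 ((i + 1) / 2 + 2 * t + 1) → A.Irred) ∧
    (∀ k ∈ Set.Icc t ((i - 3) / 4),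
      ∀ T : NumericalSemigroup, T.carrier = Tset ((i + 1) / 2 + 2 * k + 1) → T.Irred) ∧
    (Sset i ⊂ ⋂ k ∈ Set.Icc t ((i - 3) / 4), Tset ((i + 1) / 2 + 2 * k + 1)) ∧
    (∀ k₀ ∈ Set.Icc t ((i - 3) / 4),
      Sset i ⊂ gen2 ((i + 1) / 2 + 2 * t + 1) ∩
        ⋂ k ∈ Set.Icc t ((i - 3) / 4) \ {k₀}, Tset ((i + 1) / 2 + 2 * k + 1)) := by
  obtain ⟨m, rfl⟩ : ∃ m, i = 4 * m + 3 := ⟨i / 4, by omega⟩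
  have hhalf : (4 * m + 3 + 1) / 2 = 2 * m + 2 := by omega
  have hquarter : (4 * m + 3 - 3) / 4 = m := by omega
  rw [hquarter] at ht
  have memS : ∀ n, n ∈ Sset (4 * m + 3) ↔ n = 0 ∨ 2 * m + 2 ≤ n ∧ (n % 2 = 0 ∨ 4 * m + 3 < n) :=
    fun n => by rw [mem_Sset_iff (by omega), hhalf]
  have memG : ∀ n, n ∈ gen2 (2 * m + 2 + 2 * t + 1) ↔ n % 2 = 0 ∨ 2 * m + 2 + 2 * t + 1 ≤ n :=
    mem_gen2_iff (by omega)
  have memT : ∀ k n, n ∈ Tset (2 * m + 2 + 2 * k + 1) ↔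
      n = 0 ∨ m + k + 2 ≤ n ∧ n ≠ 2 * m + 2 + 2 * k + 1 := by
    intro k n
    rw [mem_Tset_iff (by omega)]
    omega
  rw [hhalf, hquarter]
  have hS : Sset (4 * m + 3) = gen2 (2 * m + 2 + 2 * t + 1) ∩
      ⋂ k ∈ Set.Icc t m, Tset (2 * m + 2 + 2 * k + 1) := by
    ext n
    simp only [Set.mem_inter_iff, Set.mem_iInter, Set.mem_Icc, memS, memG, memT]
    constructor
    · intro h
      exact ⟨by omega, fun k hk => by omega⟩
    · rintro ⟨hG, hT⟩
      have hlast := hT m ⟨ht, le_rfl⟩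
      by_cases hn : n % 2 = 0
      · omega
      · by_cases hle : n ≤ 4 * m + 3
        · have hgap := hT ((n - (2 * m + 3)) / 2) (by omega)
          omega
        · omega
  refine ⟨hS, fun A => irred_of_carrier_eq_gen2 (by omega) (by omega),
    fun k _ T => irred_of_carrier_eq_Tset (by omega), ?_, ?_⟩
  · refine (Set.ssubset_iff_of_subset (hS.trans_subset Set.inter_subset_right)).2
      ⟨2 * m + 3, ?_, ?_⟩
    · simp only [Set.mem_iInter, Set.mem_Icc, memT]
      intro k hk
      omega
    · rw [memS]; omega
  · rintro k₀ ⟨htk, hkm⟩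
    refine (Set.ssubset_iff_of_subset (hS.trans_subset (Set.inter_subset_inter_right _
      (Set.biInter_subset_biInter_left Set.sdiff_subset)))).2 ⟨2 * m + 2 + 2 * k₀ + 1, ?_, ?_⟩
    · simp only [Set.mem_inter_iff, Set.mem_iInter, Set.mem_sdiff, Set.mem_Icc,
        Set.mem_singleton_iff, memG, memT]
      exact ⟨by omega, fun k hk => by omega⟩
    · rw [memS]; omega
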